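/- For every n ≥ 0 and t > 0, the Hankel determinants factorize as D_{2n}(t) = D̃_n(t, 1/2) · D̃_n(t, −1/2) and D_{2n+1}(t) = D̃_n(t, 1/2) · D̃_{n+1}(t, −1/2). -/

import Mathlib

open MeasureTheory

/-- The singularly perturbed Gaussian weight `w(x,t) = exp(-x^2 - t/x^2)` for `x ≠ 0`,
extended by `0` at `x = 0`. -/
noncomputable def w (t x : ℝ) : ℝ := if x = 0 then 0 else Real.exp (-x ^ 2 - t / x ^ 2)

/-- If the odd entries of a sequence vanish, its Hankel determinant of size `a + b` with
`b ≤ a ≤ b + 1` splits into the Hankel determinants of the two even-indexed subsequences. -/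
lemma hankel_det_eq_mul_of_odd_eq_zero {R : Type*} [CommRing R] (f : ℕ → R)
    (hf : ∀ k, f (2 * k + 1) = 0) (a b N : ℕ) (hN : a + b = N) (hab : b ≤ a) (hba : a ≤ b + 1) :
    (Matrix.of fun i j : Fin N => f ((i : ℕ) + (j : ℕ))).det =
      (Matrix.of fun i j : Fin a => f (2 * ((i : ℕ) + (j : ℕ)))).det *
      (Matrix.of fun i j : Fin b => f (2 * ((i : ℕ) + (j : ℕ) + 1))).det := by
  let g : Fin a ⊕ Fin b → Fin N :=
    Sum.elim (fun i => ⟨2 * i, by omega⟩) (fun i => ⟨2 * i + 1, by omega⟩)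
  have hg : Function.Bijective g := by
    rw [Fintype.bijective_iff_injective_and_card]
    refine ⟨?_, by simp [hN]⟩
    rintro (i | i) (j | j) h <;> simp only [g, Sum.elim_inl, Sum.elim_inr, Fin.mk.injEq] at h
    · exact congrArg Sum.inl (Fin.ext (by omega))
    · omega
    · omega
    · exact congrArg Sum.inr (Fin.ext (by omega))
  rw [← Matrix.det_submatrix_equiv_self (Equiv.ofBijective g hg), ← Matrix.det_fromBlocks_zero₂₁ _ 0]
  congr 1
  ext (i | i) (j | j) <;>
    simp only [Matrix.submatrix_apply, Matrix.of_apply, Equiv.ofBijective_apply, g, Sum.elim_inl,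
      Sum.elim_inr, Matrix.fromBlocks_apply₁₁, Matrix.fromBlocks_apply₁₂,
      Matrix.fromBlocks_apply₂₁, Matrix.fromBlocks_apply₂₂, Matrix.zero_apply]
  · congr 1; ring
  · rw [← hf (i + j)]; congr 1; ring
  · rw [← hf (i + j)]; congr 1; ring
  · congr 1; ring

lemma w_neg (t x : ℝ) : w t (-x) = w t x := by simp [w]

lemma integral_odd_pow_mul_w (t : ℝ) (k : ℕ) : ∫ x : ℝ, x ^ (2 * k + 1) * w t x = 0 := by
  have h := integral_neg_eq_self (fun x : ℝ => x ^ (2 * k + 1) * w t x) volume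
  simp only [w_neg, (odd_two_mul_add_one k).neg_pow, neg_mul, integral_neg] at h
  linarith

lemma integral_even_pow_mul_w (t : ℝ) (k : ℕ) :
    ∫ x : ℝ, x ^ (2 * k) * w t x =
      ∫ x in Set.Ioi (0 : ℝ), x ^ k * x ^ (-(1 / 2) : ℝ) * Real.exp (-x - t / x) := by
  have habs : ∀ x : ℝ, x ^ (2 * k) * w t x = |x| ^ (2 * k) * w t |x| := fun x => by
    simp [w, pow_mul]
  rw [funext habs, integral_comp_abs (f := fun x => x ^ (2 * k) * w t x),
    ← integral_comp_rpow_Ioi_of_pos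
      (g := fun x => x ^ k * x ^ (-(1 / 2) : ℝ) * Real.exp (-x - t / x)) (p := 2) two_pos, ← integral_const_mul]
  refine setIntegral_congr_fun measurableSet_Ioi fun x hx => ?_
  have hx : 0 < x := hx
  have hrpow : (x ^ 2) ^ (-(1 / 2) : ℝ) = x⁻¹ := by
    rw [← Real.rpow_natCast x 2, ← Real.rpow_mul hx.le]
    norm_num [Real.rpow_neg_one]
  norm_num [w, hx.ne', pow_mul] at hrpow ⊢
  rw [hrpow]
  field_simp

lemma integral_even_pow_succ_mul_w (t : ℝ) (k : ℕ) :
    ∫ x : ℝ, x ^ (2 * (k + 1)) * w t x =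
      ∫ x in Set.Ioi (0 : ℝ), x ^ k * x ^ (1 / 2 : ℝ) * Real.exp (-x - t / x) := by
  rw [integral_even_pow_mul_w]
  refine setIntegral_congr_fun measurableSet_Ioi fun x hx => ?_
  have hx : 0 < x := hx
  have hrpow : x ^ (1 / 2 : ℝ) = x * x ^ (-(1 / 2) : ℝ) := by
    rw [← Real.rpow_one_add' hx.le (by norm_num)]
    norm_num
  simp only [hrpow]
  ring

theorem statement19
    (t : ℝ) (ht : 0 < t)
    (D : ℕ → ℝ → ℝ)
    (hD : ∀ n : ℕ, ∀ t : ℝ, D n t = Matrix.det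
      (Matrix.of fun i j : Fin n => ∫ x : ℝ, x ^ ((i : ℕ) + (j : ℕ)) * w t x))
    (Dt : ℕ → ℝ → ℝ → ℝ)
    (hDt : ∀ n : ℕ, ∀ t α : ℝ, Dt n t α = Matrix.det
      (Matrix.of fun i j : Fin n => ∫ x in Set.Ioi (0 : ℝ),
        x ^ ((i : ℕ) + (j : ℕ)) * x ^ α * Real.exp (-x - t / x)))
    (n : ℕ) :
    D (2 * n) t = Dt n t (1 / 2) * Dt n t (-(1 / 2)) ∧
    D (2 * n + 1) t = Dt n t (1 / 2) * Dt (n + 1) t (-(1 / 2)) := by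
  simp only [hD, hDt, ← integral_even_pow_mul_w, ← integral_even_pow_succ_mul_w]
  constructor
  · rw [mul_comm (Matrix.det _)]
    exact hankel_det_eq_mul_of_odd_eq_zero (fun k => ∫ x : ℝ, x ^ k * w t x)
      (integral_odd_pow_mul_w t) n n _ (by omega) (by omega) (by omega)
  · rw [mul_comm (Matrix.det _)]
    exact hankel_det_eq_mul_of_odd_eq_zero (fun k => ∫ x : ℝ, x ^ k * w t x)
      (integral_odd_pow_mul_w t) (n + 1) n _ (by omega) (by omega) (by omega)
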